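/- arXiv:2208.14498 — 3 statements merged into one kernel-verified Lean document; each statement's English description precedes it below -/
import Mathlib

section
/- The shadow of the suspension shadow set equals the relative Hofer norm: shadow(Σ_H) = ‖H‖_L. (This is the quantitative content of the paper's Example on suspension cobordisms: the shadow of the Lagrangian suspension K_H of a compactly supported time-dependent Hamiltonian H over a Lagrangian L equals the relative Hofer norm of H, because the projection of K_H to the ℂ-factor is exactly the set Σ_H.) -/
open MeasureTheory

/-- The shadow of a subset `S ⊆ ℂ`: the infimum in `[0,∞]` of the Lebesgue
measures of open simply connected subsets `U ⊆ ℂ` containing `S`. -/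
noncomputable def shadow (S : Set ℂ) : ENNReal :=
  ⨅ (U : Set ℂ) (_ : IsOpen U ∧ SimplyConnectedSpace U ∧ S ⊆ U), volume U

/-- The suspension shadow set `Σ_H = {t + i·H(t,x) : t ∈ ℝ, x ∈ L}`. -/
def suspensionShadowSet (L : Type) [TopologicalSpace L] (H : ℝ × L → ℝ) : Set ℂ :=
  {z : ℂ | ∃ t : ℝ, ∃ x : L, z = (t : ℂ) + Complex.I * (H (t, x) : ℂ)}

/-- The relative Hofer norm `‖H‖_L = ∫ (sup_x H(t,x) − inf_x H(t,x)) dt`. -/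
noncomputable def relHoferNorm (L : Type) [TopologicalSpace L] (H : ℝ × L → ℝ) : ℝ :=
  ∫ t : ℝ, ((⨆ x : L, H (t, x)) - ⨅ x : L, H (t, x))

/-- The open region of `ℂ` between the graphs of `f` and `g` over the real axis. -/
def openBand (f g : ℝ → ℝ) : Set ℂ :=
  {z : ℂ | f z.re < z.im ∧ z.im < g z.re}

theorem isOpen_openBand {f g : ℝ → ℝ} (hf : Continuous f) (hg : Continuous g) :
    IsOpen (openBand f g) :=
  (isOpen_lt (hf.comp Complex.continuous_re) Complex.continuous_im).inter
    (isOpen_lt Complex.continuous_im (hg.comp Complex.continuous_re))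

theorem contractibleSpace_openBand {f g : ℝ → ℝ} (hf : Continuous f) (hg : Continuous g)
    (hfg : ∀ t, f t < g t) : ContractibleSpace (openBand f g) := by
  have hne (t : ℝ) : g t - f t ≠ 0 := (sub_pos.2 (hfg t)).ne'
  let e : openBand f g ≃ₜ (Set.univ ×ˢ Set.Ioo 0 1 : Set (ℝ × ℝ)) :=
    { toFun := fun z => ⟨(z.1.re, (z.1.im - f z.1.re) / (g z.1.re - f z.1.re)), trivial,
        div_pos (sub_pos.2 z.2.1) (sub_pos.2 (hfg _)),
        (div_lt_one (sub_pos.2 (hfg _))).2 (sub_lt_sub_right z.2.2 _)⟩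
      invFun := fun p => ⟨⟨p.1.1, f p.1.1 + p.1.2 * (g p.1.1 - f p.1.1)⟩, by
        obtain ⟨⟨t, s⟩, -, h0, h1⟩ := p
        have := hfg t
        constructor <;> dsimp only at * <;> nlinarith⟩
      left_inv := fun z => by
        ext
        apply Complex.ext
        · rfl
        · simp [div_mul_cancel₀ _ (hne z.1.re)]
      right_inv := fun p => by
        ext
        · rfl
        · simp [mul_div_cancel_right₀ _ (hne p.1.1)]
      continuous_toFun := by
        refine Continuous.subtype_mk ?_ _
        have hre : Continuous fun z : openBand f g => z.1.re := by fun_prop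
        have him : Continuous fun z : openBand f g => z.1.im := by fun_prop
        exact hre.prodMk ((him.sub (hf.comp hre)).div ((hg.comp hre).sub (hf.comp hre))
          fun z => hne _)
      continuous_invFun := by
        refine Continuous.subtype_mk ?_ _
        refine Complex.equivRealProdCLM.symm.continuous.comp
          (f := fun p : (Set.univ ×ˢ Set.Ioo 0 1 : Set (ℝ × ℝ)) =>
            (p.1.1, f p.1.1 + p.1.2 * (g p.1.1 - f p.1.1))) ?_
        fun_prop }
  have := (convex_univ.prod (convex_Ioo (0 : ℝ) 1)).contractibleSpace
    (s := (Set.univ ×ˢ Set.Ioo 0 1 : Set (ℝ × ℝ))) ⟨(0, 1 / 2), trivial, by norm_num⟩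
  exact e.contractibleSpace

theorem volume_openBand {f g : ℝ → ℝ} (hf : Integrable f) (hg : Integrable g)
    (hfg : ∀ t, f t ≤ g t) :
    volume (openBand f g) = ENNReal.ofReal (∫ t, (g t - f t)) := by
  have h := volume_regionBetween_eq_integral (μ := volume) hf.integrableOn hg.integrableOn
    MeasurableSet.univ fun t _ => hfg t
  rw [setIntegral_univ] at h
  simp only [Pi.sub_apply] at h
  rw [← h, ← Measure.volume_eq_prod,
    ← Complex.volume_preserving_equiv_real_prod.measure_preimage_equiv]
  congr 1
  ext z
  simp [openBand, regionBetween]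

section Fibers

variable {L : Type} [TopologicalSpace L] {H : ℝ × L → ℝ}

theorem exists_isCompact_fiber_eq_zero (hsupp : HasCompactSupport H) :
    ∃ K : Set ℝ, IsCompact K ∧ ∀ t ∉ K, ∀ x, H (t, x) = 0 :=
  ⟨Prod.fst '' tsupport H, hsupp.isCompact.image continuous_fst, fun t ht x =>
    image_eq_zero_of_notMem_tsupport fun h => ht ⟨(t, x), h, rfl⟩⟩

theorem openBand_subset_suspensionShadowSet [ConnectedSpace L] (hH : Continuous H) :
    openBand (fun t => ⨅ x, H (t, x)) (fun t => ⨆ x, H (t, x)) ⊆ suspensionShadowSet L H := by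
  rintro z ⟨hlo, hhi⟩
  obtain ⟨a, ha⟩ := exists_lt_of_ciInf_lt hlo
  obtain ⟨b, hb⟩ := exists_lt_of_lt_ciSup hhi
  obtain ⟨x, hx⟩ := mem_range_of_exists_le_of_exists_ge
    (hH.comp (by fun_prop : Continuous fun x : L => (z.re, x))) ⟨a, ha.le⟩ ⟨b, hb.le⟩
  refine ⟨z.re, x, Complex.ext ?_ ?_⟩
  · simp
  · simpa using hx.symm

variable [CompactSpace L]

theorem isCompact_range_fiber (hH : Continuous H) (t : ℝ) :
    IsCompact (Set.range fun x => H (t, x)) :=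
  isCompact_range (hH.comp (by fun_prop))

theorem continuous_iSup_fiber (hH : Continuous H) : Continuous fun t => ⨆ x, H (t, x) := by
  simpa [iSup] using
    (isCompact_univ (X := L)).continuous_sSup (f := fun t x => H (t, x)) hH

theorem continuous_iInf_fiber (hH : Continuous H) : Continuous fun t => ⨅ x, H (t, x) := by
  simpa [iInf] using
    (isCompact_univ (X := L)).continuous_sInf (f := fun t x => H (t, x)) hH

theorem integrable_iSup_fiber [Nonempty L] (hH : Continuous H) (hsupp : HasCompactSupport H) :
    Integrable fun t => ⨆ x, H (t, x) := by
  obtain ⟨K, hK, h0⟩ := exists_isCompact_fiber_eq_zero hsupp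
  exact (continuous_iSup_fiber hH).integrable_of_hasCompactSupport
    (HasCompactSupport.intro hK fun t ht => by simp [h0 t ht])

theorem integrable_iInf_fiber [Nonempty L] (hH : Continuous H) (hsupp : HasCompactSupport H) :
    Integrable fun t => ⨅ x, H (t, x) := by
  obtain ⟨K, hK, h0⟩ := exists_isCompact_fiber_eq_zero hsupp
  exact (continuous_iInf_fiber hH).integrable_of_hasCompactSupport
    (HasCompactSupport.intro hK fun t ht => by simp [h0 t ht])

theorem iInf_fiber_le_iSup_fiber [Nonempty L] (hH : Continuous H) (t : ℝ) :
    ⨅ x, H (t, x) ≤ ⨆ x, H (t, x) :=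
  ciInf_le_ciSup (isCompact_range_fiber hH t).bddBelow (isCompact_range_fiber hH t).bddAbove

theorem suspensionShadowSet_subset_openBand (hH : Continuous H) {f g : ℝ → ℝ}
    (hf : ∀ t, f t < ⨅ x, H (t, x)) (hg : ∀ t, ⨆ x, H (t, x) < g t) :
    suspensionShadowSet L H ⊆ openBand f g := by
  rintro z ⟨t, x, rfl⟩
  have hlo := (hf t).trans_le (ciInf_le (isCompact_range_fiber hH t).bddBelow x)
  have hhi := (le_ciSup (isCompact_range_fiber hH t).bddAbove x).trans_lt (hg t)
  constructor <;> simpa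

end Fibers

/-- The shadow of the suspension shadow set equals the relative Hofer norm. -/
theorem shadow_suspensionShadowSet_eq_relHoferNorm
    (L : Type) [TopologicalSpace L] [CompactSpace L] [ConnectedSpace L] [Nonempty L]
    (H : ℝ × L → ℝ) (hH : Continuous H) (hsupp : HasCompactSupport H) :
    shadow (suspensionShadowSet L H) = ENNReal.ofReal (relHoferNorm L H) := by
  have hM := integrable_iSup_fiber hH hsupp
  have hm := integrable_iInf_fiber hH hsupp
  apply le_antisymm
  · have hbound (ε : ℝ) (hε : 0 < ε) : shadow (suspensionShadowSet L H) ≤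
        ENNReal.ofReal (relHoferNorm L H + ε * (2 * ∫ t : ℝ, Real.exp (-1 * t ^ 2))) := by
      have hexp : Integrable fun t : ℝ => Real.exp (-1 * t ^ 2) :=
        integrable_exp_neg_mul_sq one_pos
      have hpos (t : ℝ) : 0 < ε * Real.exp (-1 * t ^ 2) := by positivity
      let f : ℝ → ℝ := fun t => (⨅ x, H (t, x)) - ε * Real.exp (-1 * t ^ 2)
      let g : ℝ → ℝ := fun t => (⨆ x, H (t, x)) + ε * Real.exp (-1 * t ^ 2)
      have hf (t : ℝ) : f t < ⨅ x, H (t, x) := sub_lt_self _ (hpos t)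
      have hg (t : ℝ) : ⨆ x, H (t, x) < g t := lt_add_of_pos_right _ (hpos t)
      have hfg (t : ℝ) : f t < g t :=
        (hf t).trans_le ((iInf_fiber_le_iSup_fiber hH t).trans (hg t).le)
      have hfc : Continuous f := (continuous_iInf_fiber hH).sub (by fun_prop)
      have hgc : Continuous g := (continuous_iSup_fiber hH).add (by fun_prop)
      have := contractibleSpace_openBand hfc hgc hfg
      refine (iInf₂_le (openBand f g) ⟨isOpen_openBand hfc hgc, inferInstance,
        suspensionShadowSet_subset_openBand hH hf hg⟩).trans_eq ?_
      rw [volume_openBand (f := f) (g := g) (hm.sub (hexp.const_mul ε)) (hM.add (hexp.const_mul ε))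
        fun t => (hfg t).le]
      congr 1
      rw [relHoferNorm, ← integral_const_mul, ← integral_const_mul,
        ← integral_add (f := fun t => (⨆ x, H (t, x)) - ⨅ x, H (t, x)) (hM.sub hm)
          ((hexp.const_mul 2).const_mul ε)]
      congr 1
      ext t
      simp only [f, g]
      ring
    have hlim : Filter.Tendsto (fun ε : ℝ => ENNReal.ofReal
        (relHoferNorm L H + ε * (2 * ∫ t : ℝ, Real.exp (-1 * t ^ 2))))
        (nhdsWithin 0 (Set.Ioi 0)) (nhds (ENNReal.ofReal (relHoferNorm L H))) := by
      refine ENNReal.tendsto_ofReal (tendsto_nhdsWithin_of_tendsto_nhds ?_)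
      refine Continuous.tendsto' (by fun_prop) _ _ (by simp)
    exact ge_of_tendsto hlim (eventually_mem_nhdsWithin.mono hbound)
  · refine le_iInf₂ fun U hU => ?_
    rw [relHoferNorm, ← volume_openBand hm hM (iInf_fiber_le_iSup_fiber hH)]
    exact measure_mono ((openBand_subset_suspensionShadowSet hH).trans hU.2.2)
end

section
/- Every measurable subset U ⊆ ℂ containing the suspension shadow set Σ_H has Lebesgue measure at least ‖H‖_L; in particular, the Lebesgue measure of Σ_H itself equals ‖H‖_L. (This is the lower-bound half of the paper's claim that the shadow of a suspension cobordism equals the Hofer norm.) -/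
open MeasureTheory

section ContinuousExtrema

variable {X L : Type*} [TopologicalSpace X] [TopologicalSpace L] [CompactSpace L]

theorem continuous_iSup_of_compactSpace {H : X × L → ℝ} (hH : Continuous H) :
    Continuous fun t => ⨆ x : L, H (t, x) := by
  have h := isCompact_univ.continuous_sSup (f := fun (t : X) (x : L) => H (t, x)) hH
  simpa only [Set.image_univ, sSup_range] using h

theorem continuous_iInf_of_compactSpace {H : X × L → ℝ} (hH : Continuous H) :
    Continuous fun t => ⨅ x : L, H (t, x) := by
  have h := isCompact_univ.continuous_sInf (f := fun (t : X) (x : L) => H (t, x)) hH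
  simpa only [Set.image_univ, sInf_range] using h

end ContinuousExtrema

/-- A continuous function on a nonempty compact connected space has range the interval
between its infimum and its supremum. -/
theorem range_eq_Icc_iInf_iSup {L : Type*} [TopologicalSpace L] [CompactSpace L]
    [ConnectedSpace L] {f : L → ℝ} (hf : Continuous f) :
    Set.range f = Set.Icc (⨅ x, f x) (⨆ x, f x) :=
  eq_Icc_of_connected_compact (isConnected_range hf) (isCompact_range hf)

theorem hasCompactSupport_iSup_sub_iInf {X L : Type*} [TopologicalSpace X] [R1Space X]
    [TopologicalSpace L] {H : X × L → ℝ} (hsupp : HasCompactSupport H) :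
    HasCompactSupport fun t => (⨆ x : L, H (t, x)) - ⨅ x : L, H (t, x) := by
  refine HasCompactSupport.intro' (hsupp.isCompact.image continuous_fst).closure
    isClosed_closure fun t ht => ?_
  have hz : ∀ x, H (t, x) = 0 := fun x => by
    by_contra hne
    exact ht (subset_closure ⟨(t, x), subset_tsupport H hne, rfl⟩)
  simp [hz]

/-- The volume of the region between the graphs of two continuous functions, boundary
included. -/
theorem Complex.volume_setOf_im_mem_Icc {f g : ℝ → ℝ} (hf : Continuous f) (hg : Continuous g)
    (hfg : f ≤ g) (hint : Integrable fun t => g t - f t) :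
    volume {z : ℂ | z.im ∈ Set.Icc (f z.re) (g z.re)} =
      ENNReal.ofReal (∫ t, (g t - f t)) := by
  have hclosed : IsClosed {p : ℝ × ℝ | p.2 ∈ Set.Icc (f p.1) (g p.1)} :=
    (isClosed_le (hf.comp continuous_fst) continuous_snd).inter
      (isClosed_le continuous_snd (hg.comp continuous_fst))
  have hpre := Complex.volume_preserving_equiv_real_prod.measure_preimage
    hclosed.measurableSet.nullMeasurableSet
  calc volume {z : ℂ | z.im ∈ Set.Icc (f z.re) (g z.re)}
      = volume {p : ℝ × ℝ | p.2 ∈ Set.Icc (f p.1) (g p.1)} := hpre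
    _ = ∫⁻ t, volume (Set.Icc (f t) (g t)) := by
        rw [Measure.volume_eq_prod, Measure.prod_apply hclosed.measurableSet]
        rfl
    _ = ENNReal.ofReal (∫ t, (g t - f t)) := by
        simp only [Real.volume_Icc]
        rw [ofReal_integral_eq_lintegral_ofReal hint
          (Filter.Eventually.of_forall fun t => sub_nonneg.2 (hfg t))]

theorem suspensionShadowSet_eq (L : Type) [TopologicalSpace L] [CompactSpace L]
    [ConnectedSpace L] {H : ℝ × L → ℝ} (hH : Continuous H) :
    suspensionShadowSet L H =
      {z : ℂ | z.im ∈ Set.Icc (⨅ x : L, H (z.re, x)) (⨆ x : L, H (z.re, x))} := by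
  ext z
  rw [Set.mem_ofPred_eq, ← range_eq_Icc_iInf_iSup (by fun_prop : Continuous fun x => H (z.re, x))]
  constructor
  · rintro ⟨t, x, rfl⟩
    exact ⟨x, by simp⟩
  · rintro ⟨x, hx⟩
    exact ⟨z.re, x, by apply Complex.ext <;> simp [← hx]⟩

theorem volume_suspensionShadowSet (L : Type) [TopologicalSpace L] [CompactSpace L]
    [ConnectedSpace L] {H : ℝ × L → ℝ} (hH : Continuous H) (hsupp : HasCompactSupport H) :
    volume (suspensionShadowSet L H) = ENNReal.ofReal (relHoferNorm L H) := by
  have hM := continuous_iSup_of_compactSpace hH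
  have hm := continuous_iInf_of_compactSpace hH
  rw [suspensionShadowSet_eq L hH]
  refine Complex.volume_setOf_im_mem_Icc hm hM (fun t => ?_)
    ((hM.sub hm).integrable_of_hasCompactSupport (hasCompactSupport_iSup_sub_iInf hsupp))
  have hcpt := isCompact_range (by fun_prop : Continuous fun x => H (t, x))
  exact ciInf_le_ciSup hcpt.bddBelow hcpt.bddAbove

/-- Every measurable subset of `ℂ` containing the suspension shadow set has
Lebesgue measure at least the relative Hofer norm, and the Lebesgue measure of
the suspension shadow set itself equals the relative Hofer norm. -/
theorem volume_ge_relHoferNorm_of_suspensionShadowSet_subset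
    (L : Type) [TopologicalSpace L] [CompactSpace L] [ConnectedSpace L] [Nonempty L]
    (H : ℝ × L → ℝ) (hH : Continuous H) (hsupp : HasCompactSupport H) :
    (∀ U : Set ℂ, MeasurableSet U → suspensionShadowSet L H ⊆ U →
      ENNReal.ofReal (relHoferNorm L H) ≤ volume U) ∧
    volume (suspensionShadowSet L H) = ENNReal.ofReal (relHoferNorm L H) := by
  have hvol := volume_suspensionShadowSet L hH hsupp
  exact ⟨fun U _ hU => hvol ▸ measure_mono hU, hvol⟩
end

section
/- If U ⊆ ℂ is open and connected, and for every t ∈ ℝ the vertical slice {y ∈ ℝ : t + i·y ∈ U} is order-convex (an interval, possibly empty), then U, with the subspace topology, is simply connected. (This vertical-convexity criterion is what makes the thickened regions between graphs used in the paper's shadow constructions simply connected.) -/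
/-- An open set whose vertical slices are order-convex admits a continuous selection of
heights over its projection to the real axis. -/
theorem exists_continuous_section_of_ordConnected_vertical_slices
    {U : Set ℂ} (hopen : IsOpen U)
    (hslice : ∀ t : ℝ, Set.OrdConnected {y : ℝ | ((t : ℂ) + Complex.I * (y : ℂ)) ∈ U}) :
    ∃ g : C(Complex.re '' U, ℝ),
      ∀ t : Complex.re '' U, ((t : ℝ) : ℂ) + Complex.I * (g t : ℂ) ∈ U := by
  refine exists_continuous_forall_mem_convex_of_local_const
    (t := fun t : Complex.re '' U => {y : ℝ | (((t : ℝ) : ℂ) + Complex.I * (y : ℂ)) ∈ U})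
    (fun t => (hslice t).convex) ?_
  rintro ⟨_, z, hz, rfl⟩
  refine ⟨z.im, ?_⟩
  have hcont : Continuous fun t : Complex.re '' U =>
      ((t : ℝ) : ℂ) + Complex.I * (z.im : ℂ) := by fun_prop
  refine (hopen.preimage hcont).mem_nhds ?_
  simpa [mul_comm Complex.I, Complex.re_add_im] using hz

/-- A set with order-convex vertical slices is homotopy equivalent to its projection to the real
axis as soon as the projection has a continuous section. -/
theorem nonempty_homotopyEquiv_re_image
    {U : Set ℂ}
    (hslice : ∀ t : ℝ, Set.OrdConnected {y : ℝ | ((t : ℂ) + Complex.I * (y : ℂ)) ∈ U})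
    (g : C(Complex.re '' U, ℝ))
    (hg : ∀ t : Complex.re '' U, ((t : ℝ) : ℂ) + Complex.I * (g t : ℂ) ∈ U) :
    Nonempty (ContinuousMap.HomotopyEquiv U (Complex.re '' U)) := by
  let p : C(U, Complex.re '' U) :=
    ⟨fun z => ⟨(z : ℂ).re, Set.mem_image_of_mem _ z.2⟩, by fun_prop⟩
  let s : C(Complex.re '' U, U) := ⟨fun t => ⟨_, hg t⟩, by fun_prop⟩
  have hmem (x : unitInterval × U) :
      (((x.2 : ℂ).re : ℝ) : ℂ) + Complex.I *
        (((1 - (x.1 : ℝ)) * g (p x.2) + x.1 * (x.2 : ℂ).im : ℝ) : ℂ) ∈ U := by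
    have him : (x.2 : ℂ).im ∈ {y : ℝ | (((x.2 : ℂ).re : ℂ) + Complex.I * (y : ℂ)) ∈ U} := by
      simp [mul_comm Complex.I, Complex.re_add_im]
    exact (hslice (x.2 : ℂ).re).convex (hg (p x.2)) him
      (sub_nonneg.2 x.1.2.2) x.1.2.1 (sub_add_cancel _ _)
  refine ⟨⟨p, s, ⟨⟨⟨fun x => ⟨_, hmem x⟩, by fun_prop⟩, fun z => ?_, fun z => ?_⟩⟩, ?_⟩⟩
  · ext
    simp [p, s]
  · ext
    simp [mul_comm Complex.I, Complex.re_add_im]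
  · convert ContinuousMap.Homotopic.refl (ContinuousMap.id (Complex.re '' U)) using 1
    ext t
    simp [p, s]

/-- An open connected subset of `ℂ` all of whose vertical slices are
order-convex is simply connected. -/
theorem simplyConnected_of_ordConnected_vertical_slices
    (U : Set ℂ) (hopen : IsOpen U) (hconn : IsConnected U)
    (hslice : ∀ t : ℝ, Set.OrdConnected {y : ℝ | ((t : ℂ) + Complex.I * (y : ℂ)) ∈ U}) :
    SimplyConnectedSpace U := by
  obtain ⟨g, hg⟩ := exists_continuous_section_of_ordConnected_vertical_slices hopen hslice
  obtain ⟨e⟩ := nonempty_homotopyEquiv_re_image hslice g hg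
  have himage := hconn.image Complex.re Complex.continuous_re.continuousOn
  have : ContractibleSpace (Complex.re '' U) :=
    himage.isPreconnected.ordConnected.convex.contractibleSpace himage.nonempty
  exact e.simplyConnectedSpace
end
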